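/- Fix y₀ ∈ U and η₀ ∈ ℝ^{n-1} with ⟨A(0,y₀)η₀, η₀⟩ = 1. For every δ > 0 there exists s₀ > 0, depending only on δ, n, λ, Λ, such that for every short-geodesic trajectory with data (y₀, η₀, s) with 0 < s < s₀ one has, for all t ∈ [0,T]: x(t) + ‖y(t) − y₀‖ + |ξ(t)| + ‖η(t) − η₀‖ < δ, and moreover the g-length s·T of the trajectory satisfies s·T < δ. In other words, as s → 0 the short geodesics converge in the cotangent bundle to the point (0, y₀, 0, η₀) uniformly in t, and their lengths tend to 0. -/

import Mathlib

open Set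

noncomputable section

/-- `quadForm M v w = ⟨M v, w⟩`, the bilinear form of the matrix `M` with respect to the
standard inner product on `ℝ^m`. -/
def quadForm {m : ℕ} (M : Matrix (Fin m) (Fin m) ℝ) (v w : Fin m → ℝ) : ℝ :=
  ∑ i, (∑ j, M i j * v j) * w i

/-- The Euclidean norm of a vector in `ℝ^m`. -/
def euclNorm {m : ℕ} (v : Fin m → ℝ) : ℝ :=
  Real.sqrt (∑ i, v i ^ 2)

/-- Entrywise partial derivative `∂ₓ A` of a matrix-valued map in its first (scalar) variable. -/
def dxA {m : ℕ} (A : ℝ → (Fin m → ℝ) → Matrix (Fin m) (Fin m) ℝ)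
    (x : ℝ) (y : Fin m → ℝ) : Matrix (Fin m) (Fin m) ℝ :=
  Matrix.of fun i j => deriv (fun x' => A x' y i j) x

/-- Entrywise partial derivative `∂_{y k} A` of a matrix-valued map in the `k`-th component of
its second (vector) variable. -/
def dyA {m : ℕ} (A : ℝ → (Fin m → ℝ) → Matrix (Fin m) (Fin m) ℝ)
    (k : Fin m) (x : ℝ) (y : Fin m → ℝ) : Matrix (Fin m) (Fin m) ℝ :=
  Matrix.of fun i j => deriv (fun s => A x (Function.update y k s) i j) (y k)

/-- Partial derivative `∂ₓ f` of a scalar function of `(x, y)`. -/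
def dxF {m : ℕ} (f : ℝ → (Fin m → ℝ) → ℝ) (x : ℝ) (y : Fin m → ℝ) : ℝ :=
  deriv (fun x' => f x' y) x

/-- Partial derivative `∂_{y k} f` of a scalar function of `(x, y)`. -/
def dyF {m : ℕ} (f : ℝ → (Fin m → ℝ) → ℝ) (k : Fin m) (x : ℝ) (y : Fin m → ℝ) : ℝ :=
  deriv (fun s => f x (Function.update y k s)) (y k)

/-- Iterated partial derivative `∂ₓ^k f` of a scalar function of `(x, y)`. -/
def dxIter {m : ℕ} : ℕ → (ℝ → (Fin m → ℝ) → ℝ) → ℝ → (Fin m → ℝ) → ℝ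
  | 0, f => f
  | (k+1), f => dxF (dxIter k f)

/-- The standing hypotheses on the data of a gas giant in `g`-boundary normal coordinates:
`n ≥ 2`, `ε ∈ (0,1]`, `U ⊆ ℝ^{n-1}` open, and `A : [0,ε) × U → ℝ^{(n-1)×(n-1)}` symmetric
positive definite (with uniform ellipticity constants `0 < lam ≤ Lam`), extending to a `C^∞`
map on an open neighborhood of `[0,ε) × U`, with all first-order partial derivatives of all
entries bounded by `Lam`.  (`A` plays the role of the inverse boundary metric `h^{ij}` of the
gas giant metric `g = dx² + x⁻² h(x,y,dy)`.) -/
structure GasGiantData (n : ℕ) (ε : ℝ) (U : Set (Fin (n-1) → ℝ))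
    (A : ℝ → (Fin (n-1) → ℝ) → Matrix (Fin (n-1)) (Fin (n-1)) ℝ)
    (lam Lam : ℝ) : Prop where
  hn : 2 ≤ n
  hε : ε ∈ Set.Ioc (0:ℝ) 1
  hU : IsOpen U
  hlam : 0 < lam
  hlamLam : lam ≤ Lam
  hsymm : ∀ x ∈ Set.Ico (0:ℝ) ε, ∀ y ∈ U, (A x y).IsSymm
  hsmooth : ∃ W : Set (ℝ × (Fin (n-1) → ℝ)), IsOpen W ∧ Set.Ico (0:ℝ) ε ×ˢ U ⊆ W ∧
    ∀ i j, ContDiffOn ℝ (⊤ : ℕ∞) (fun p : ℝ × (Fin (n-1) → ℝ) => A p.1 p.2 i j) W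
  hposdef : ∀ x ∈ Set.Ico (0:ℝ) ε, ∀ y ∈ U, ∀ v : Fin (n-1) → ℝ,
    lam * (∑ i, v i ^ 2) ≤ quadForm (A x y) v v ∧ quadForm (A x y) v v ≤ Lam * (∑ i, v i ^ 2)
  hderivBound : ∀ x ∈ Set.Ico (0:ℝ) ε, ∀ y ∈ U,
    (∀ i j, |dxA A x y i j| ≤ Lam) ∧ (∀ k i j, |dyA A k x y i j| ≤ Lam)

/-- A Hamiltonian trajectory on the interval `I` for the gas giant Hamiltonian
`H(x,y,ξ,η) = ½ ξ² + ½ x² ⟨A(x,y)η, η⟩`: a `C¹` curve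
`t ↦ (x(t), y(t), ξ(t), η(t)) ∈ [0,ε) × U × ℝ × ℝ^{n-1}` satisfying Hamilton's equations. -/
structure IsHamTraj (n : ℕ) (ε : ℝ) (U : Set (Fin (n-1) → ℝ))
    (A : ℝ → (Fin (n-1) → ℝ) → Matrix (Fin (n-1)) (Fin (n-1)) ℝ) (I : Set ℝ)
    (x : ℝ → ℝ) (y : ℝ → Fin (n-1) → ℝ) (ξ : ℝ → ℝ) (η : ℝ → Fin (n-1) → ℝ) : Prop where
  mem : ∀ t ∈ I, x t ∈ Set.Ico (0:ℝ) ε ∧ y t ∈ U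
  hx : ∀ t ∈ I, HasDerivAt x (ξ t) t
  hy : ∀ t ∈ I, ∀ i, HasDerivAt (fun t' => y t' i)
    ((x t)^2 * ∑ j, A (x t) (y t) i j * η t j) t
  hxi : ∀ t ∈ I, HasDerivAt ξ
    (-(x t * quadForm (A (x t) (y t)) (η t) (η t))
      - (1/2) * (x t)^2 * quadForm (dxA A (x t) (y t)) (η t) (η t)) t
  heta : ∀ t ∈ I, ∀ i, HasDerivAt (fun t' => η t' i)
    (-(1/2) * (x t)^2 * quadForm (dyA A i (x t) (y t)) (η t) (η t)) t

/-- A short-geodesic trajectory with data `(y₀, η₀, s)`: a Hamiltonian trajectory on `[0,T]`,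
`T > 0`, with initial value `(0, y₀, s, η₀)`, with `x(T) = 0` and `x(t) > 0` on `(0,T)`. -/
def IsShortGeo (n : ℕ) (ε : ℝ) (U : Set (Fin (n-1) → ℝ))
    (A : ℝ → (Fin (n-1) → ℝ) → Matrix (Fin (n-1)) (Fin (n-1)) ℝ)
    (y₀ η₀ : Fin (n-1) → ℝ) (s T : ℝ)
    (x : ℝ → ℝ) (y : ℝ → Fin (n-1) → ℝ) (ξ : ℝ → ℝ) (η : ℝ → Fin (n-1) → ℝ) : Prop :=
  0 < T ∧ IsHamTraj n ε U A (Set.Icc 0 T) x y ξ η ∧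
    x 0 = 0 ∧ y 0 = y₀ ∧ ξ 0 = s ∧ η 0 = η₀ ∧ x T = 0 ∧ ∀ t ∈ Set.Ioo 0 T, 0 < x t

open Filter Topology

/-- The chain rule along a curve, in terms of the partial derivatives `dxF` and `dyF`. -/
lemma hasDerivAt_comp_curve {m : ℕ} {F : ℝ → (Fin m → ℝ) → ℝ} {x : ℝ → ℝ}
    {y : ℝ → Fin m → ℝ} {t a : ℝ} {b : Fin m → ℝ}
    (hF : DifferentiableAt ℝ (fun p : ℝ × (Fin m → ℝ) => F p.1 p.2) (x t, y t))
    (hx : HasDerivAt x a t) (hy : ∀ i, HasDerivAt (fun t' => y t' i) (b i) t) :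
    HasDerivAt (fun t' => F (x t') (y t'))
      (dxF F (x t) (y t) * a + ∑ k, dyF F k (x t) (y t) * b k) t := by
  obtain ⟨L, hL⟩ := hF
  have hxL : dxF F (x t) (y t) = L (1, 0) := by
    have h : HasDerivAt (fun x' : ℝ => (x', y t)) ((1 : ℝ), (0 : Fin m → ℝ)) (x t) :=
      (hasDerivAt_id _).prodMk (hasDerivAt_const _ _)
    exact (hL.comp_hasDerivAt (x t) h).deriv
  have hyL : ∀ k, dyF F k (x t) (y t) = L (0, Pi.single k 1) := by
    intro k
    have h : HasDerivAt (fun s : ℝ => (x t, Function.update (y t) k s))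
        ((0 : ℝ), (Pi.single k 1 : Fin m → ℝ)) (y t k) :=
      (hasDerivAt_const _ _).prodMk (hasDerivAt_update _ _ _)
    have hL' : HasFDerivAt (fun p : ℝ × (Fin m → ℝ) => F p.1 p.2) L
        (x t, Function.update (y t) k (y t k)) := by
      rwa [Function.update_eq_self]
    exact (hL'.comp_hasDerivAt (y t k) h).deriv
  have hcurve : HasDerivAt (fun t' => (x t', y t')) (a, b) t :=
    hx.prodMk (hasDerivAt_pi.2 hy)
  refine (hL.comp_hasDerivAt t hcurve).congr_deriv ?_
  have hab : ((a, b) : ℝ × (Fin m → ℝ))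
      = a • ((1 : ℝ), (0 : Fin m → ℝ)) + ∑ k, b k • ((0 : ℝ), (Pi.single k 1 : Fin m → ℝ)) := by
    ext i
    · simp [Prod.fst_sum]
    · simp [Prod.snd_sum, Finset.sum_apply, Pi.single_apply]
  rw [hab, map_add, map_sum, hxL]
  simp only [map_smul, hyL, smul_eq_mul, mul_comm]

/-- A matrix with entries bounded by `c` has quadratic form bounded by `c m ‖v‖²`. -/
lemma abs_quadForm_le {m : ℕ} {M : Matrix (Fin m) (Fin m) ℝ} {c : ℝ}
    (hM : ∀ i j, |M i j| ≤ c) (v : Fin m → ℝ) :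
    |quadForm M v v| ≤ c * m * ∑ i, v i ^ 2 := by
  rcases isEmpty_or_nonempty (Fin m) with h | ⟨⟨i₀⟩⟩
  · simp [quadForm]
  have hc : 0 ≤ c := (abs_nonneg _).trans (hM i₀ i₀)
  calc |quadForm M v v| ≤ ∑ i, (∑ j, c * |v j|) * |v i| := by
        refine (Finset.abs_sum_le_sum_abs _ _).trans (Finset.sum_le_sum fun i _ => ?_)
        rw [abs_mul]
        gcongr
        refine (Finset.abs_sum_le_sum_abs _ _).trans (Finset.sum_le_sum fun j _ => ?_)
        rw [abs_mul]
        gcongr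
        exact hM i j
    _ = c * (∑ i, |v i|) ^ 2 := by
        rw [← Finset.mul_sum, ← Finset.mul_sum]
        ring
    _ ≤ c * (m * ∑ i, v i ^ 2) := by
        gcongr
        simpa using sq_sum_le_card_mul_sum_sq (s := Finset.univ) (f := fun i => |v i|)
    _ = _ := by ring

lemma quadForm_comm {m : ℕ} {M : Matrix (Fin m) (Fin m) ℝ} (hM : M.IsSymm)
    (v w : Fin m → ℝ) : quadForm M v w = quadForm M w v := by
  simp only [quadForm, Finset.sum_mul]
  rw [Finset.sum_comm]
  refine Finset.sum_congr rfl fun i _ => Finset.sum_congr rfl fun j _ => ?_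
  rw [hM.apply]
  ring

lemma sum_mul_quadForm {m : ℕ} (c : Fin m → ℝ) (B : Fin m → Matrix (Fin m) (Fin m) ℝ)
    (v : Fin m → ℝ) :
    ∑ k, c k * quadForm (B k) v v = ∑ i, (∑ j, (∑ k, B k i j * c k) * v j) * v i := by
  simp only [quadForm, Finset.mul_sum, Finset.sum_mul]
  rw [Finset.sum_comm]
  refine Finset.sum_congr rfl fun i _ => ?_
  rw [Finset.sum_comm]
  refine Finset.sum_congr rfl fun j _ => Finset.sum_congr rfl fun k _ => ?_
  ring

/-- A symmetric matrix whose quadratic form lies between `0` and `c ‖v‖²` satisfies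
`|(M v)ᵢ| ≤ c (‖v‖² + 1) / 2`. -/
lemma abs_mulVec_apply_le {m : ℕ} {M : Matrix (Fin m) (Fin m) ℝ} {c : ℝ} (hM : M.IsSymm)
    (h0 : ∀ v, 0 ≤ quadForm M v v) (h1 : ∀ v, quadForm M v v ≤ c * ∑ i, v i ^ 2)
    (v : Fin m → ℝ) (i : Fin m) :
    |∑ j, M i j * v j| ≤ c / 2 * ((∑ j, v j ^ 2) + 1) := by
  set e : Fin m → ℝ := Pi.single i 1
  have he : quadForm M v e = ∑ j, M i j * v j := by
    simp [quadForm, e, Pi.single_apply]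
  have hee : ∑ j, e j ^ 2 = 1 := by
    simp [e, Pi.single_apply]
  have hexp : ∀ r : ℝ, quadForm M (fun j => v j + r * e j) (fun j => v j + r * e j)
      = quadForm M v v + 2 * r * quadForm M v e + r ^ 2 * quadForm M e e := by
    intro r
    have h : quadForm M (fun j => v j + r * e j) (fun j => v j + r * e j)
        = quadForm M v v + r * quadForm M v e + r * quadForm M e v + r ^ 2 * quadForm M e e := by
      simp only [quadForm, Finset.mul_sum, ← Finset.sum_add_distrib]
      refine Finset.sum_congr rfl fun i _ => ?_
      simp only [mul_add, Finset.sum_add_distrib, mul_left_comm _ r, ← Finset.mul_sum]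
      ring
    rw [h, quadForm_comm hM e v]
    ring
  have hp := h0 fun j => v j + 1 * e j
  have hn := h0 fun j => v j + (-1) * e j
  have hv := h1 v
  have hE := h1 e
  rw [hexp] at hp hn
  rw [hee] at hE
  rw [← he, abs_le]
  constructor <;> linarith

lemma euclNorm_le {m : ℕ} {v : Fin m → ℝ} {b : ℝ} (hv : ∀ i, |v i| ≤ b) :
    euclNorm v ≤ m * b := by
  have h : euclNorm v ≤ ∑ i, |v i| := by
    refine Real.sqrt_le_iff.2 ⟨Finset.sum_nonneg fun i _ => abs_nonneg _, ?_⟩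
    simpa using Finset.sum_sq_le_sq_sum_of_nonneg (s := Finset.univ) (f := fun i => |v i|)
      fun i _ => abs_nonneg _
  refine h.trans ((Finset.sum_le_sum fun i _ => hv i).trans ?_)
  simp

lemma abs_sub_le_of_hasDerivAt {f f' : ℝ → ℝ} {S C : ℝ}
    (hf : ∀ t ∈ Icc 0 S, HasDerivAt f (f' t) t) (hC : ∀ t ∈ Icc 0 S, |f' t| ≤ C) :
    ∀ t ∈ Icc 0 S, |f t - f 0| ≤ C * t := by
  intro t ht
  have h := norm_image_sub_le_of_norm_deriv_le_segment' (f := f) (f' := f') (C := C)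
    (fun u hu => (hf u hu).hasDerivWithinAt) (fun u hu => hC u (Ico_subset_Icc_self hu)) t ht
  simpa using h

/-- Sturm comparison: a solution of `u'' ≤ -ω² u` with `u 0 = 0` that is nonnegative on
`[0, π / ω]` is not positive at `π / ω`. -/
lemma sturm_comparison {u v w : ℝ → ℝ} {ω : ℝ} (hω : 0 < ω)
    (hu : ∀ t ∈ Icc 0 (Real.pi / ω), HasDerivAt u (v t) t)
    (hv : ∀ t ∈ Icc 0 (Real.pi / ω), HasDerivAt v (w t) t)
    (hw : ∀ t ∈ Icc 0 (Real.pi / ω), w t ≤ -(ω ^ 2 * u t)) (h0 : u 0 = 0) :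
    u (Real.pi / ω) ≤ 0 := by
  set P := Real.pi / ω with hP
  have hP0 : 0 < P := by positivity
  have hωP : ω * P = Real.pi := by rw [hP]; field_simp
  have hder : ∀ t ∈ Icc 0 P, HasDerivAt
      (fun t => v t * Real.sin (ω * t) - ω * (u t * Real.cos (ω * t)))
      ((w t + ω ^ 2 * u t) * Real.sin (ω * t)) t := by
    intro t ht
    have hl : HasDerivAt (fun t : ℝ => ω * t) ω t := by
      simpa using (hasDerivAt_id t).const_mul ω
    refine (((hv t ht).mul hl.sin).sub (((hu t ht).mul hl.cos).const_mul ω)).congr_deriv ?_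
    ring
  have hanti : AntitoneOn (fun t => v t * Real.sin (ω * t) - ω * (u t * Real.cos (ω * t)))
      (Icc 0 P) := by
    refine antitoneOn_of_deriv_nonpos (convex_Icc 0 P)
      (fun t ht => (hder t ht).continuousAt.continuousWithinAt)
      (fun t ht => (hder t (interior_subset ht)).differentiableAt.differentiableWithinAt)
      fun t ht => ?_
    have ht' := interior_subset ht
    rw [(hder t ht').deriv]
    refine mul_nonpos_of_nonpos_of_nonneg (by linarith [hw t ht']) ?_
    refine Real.sin_nonneg_of_nonneg_of_le_pi (mul_nonneg hω.le ht'.1) ?_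
    rw [← hωP]
    exact mul_le_mul_of_nonneg_left ht'.2 hω.le
  have h := hanti (left_mem_Icc.2 hP0.le) (right_mem_Icc.2 hP0.le) hP0.le
  simp only [hωP, h0, mul_zero, Real.sin_zero, Real.sin_pi, Real.cos_pi, zero_mul, sub_zero] at h
  nlinarith

/-- Conservation of the Hamiltonian. -/
lemma IsHamTraj.energy_eq {n : ℕ} {ε : ℝ} {U : Set (Fin (n-1) → ℝ)}
    {A : ℝ → (Fin (n-1) → ℝ) → Matrix (Fin (n-1)) (Fin (n-1)) ℝ} {lam Lam T : ℝ}
    {x : ℝ → ℝ} {y : ℝ → Fin (n-1) → ℝ} {ξ : ℝ → ℝ} {η : ℝ → Fin (n-1) → ℝ}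
    (hA : GasGiantData n ε U A lam Lam) (h : IsHamTraj n ε U A (Icc 0 T) x y ξ η) :
    ∀ t ∈ Icc 0 T, ξ t ^ 2 + x t ^ 2 * quadForm (A (x t) (y t)) (η t) (η t)
      = ξ 0 ^ 2 + x 0 ^ 2 * quadForm (A (x 0) (y 0)) (η 0) (η 0) := by
  have hder : ∀ t ∈ Icc 0 T, HasDerivAt
      (fun t => ξ t ^ 2 + x t ^ 2 * quadForm (A (x t) (y t)) (η t) (η t)) 0 t := by
    intro t ht
    obtain ⟨W, hW, hsub, hsm⟩ := hA.hsmooth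
    obtain ⟨hxm, hym⟩ := h.mem t ht
    set y' : Fin (n-1) → ℝ := fun i => x t ^ 2 * ∑ j, A (x t) (y t) i j * η t j with hy'
    have hdA : ∀ i j, HasDerivAt (fun t' => A (x t') (y t') i j)
        (dxA A (x t) (y t) i j * ξ t + ∑ k, dyA A k (x t) (y t) i j * y' k) t := by
      intro i j
      refine hasDerivAt_comp_curve (F := fun a b => A a b i j) ?_ (h.hx t ht) (h.hy t ht)
      exact ((hsm i j).contDiffAt (hW.mem_nhds (hsub ⟨hxm, hym⟩))).differentiableAt (by simp)
    have hQ : HasDerivAt (fun t' => quadForm (A (x t') (y t')) (η t') (η t'))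
        (quadForm (dxA A (x t) (y t)) (η t) (η t) * ξ t) t := by
      set η' : Fin (n-1) → ℝ := fun i =>
        -(1/2) * (x t)^2 * quadForm (dyA A i (x t) (y t)) (η t) (η t) with hη'
      have heta : ∀ i, HasDerivAt (fun t' => η t' i) (η' i) t := h.heta t ht
      have h1 := HasDerivAt.fun_sum (u := Finset.univ) fun i (_ : i ∈ Finset.univ) =>
        (HasDerivAt.fun_sum (u := Finset.univ) fun j (_ : j ∈ Finset.univ) =>
          (hdA i j).fun_mul (heta j)).fun_mul (heta i)
      refine h1.congr_deriv ?_
      have hsplit : quadForm (A (x t) (y t)) η' (η t) + quadForm (A (x t) (y t)) (η t) η'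
          + ∑ k, y' k * quadForm (dyA A k (x t) (y t)) (η t) (η t) = 0 := by
        rw [quadForm_comm (hA.hsymm _ hxm _ hym) η' (η t)]
        simp only [quadForm, ← Finset.sum_add_distrib]
        refine Finset.sum_eq_zero fun k _ => ?_
        simp only [hη', hy', quadForm]
        ring
      rw [← add_zero (quadForm (dxA A (x t) (y t)) (η t) (η t) * ξ t), ← hsplit]
      rw [sum_mul_quadForm]
      clear_value η' y'
      simp only [quadForm, Finset.sum_mul _ _ (ξ t), ← Finset.sum_add_distrib]
      refine Finset.sum_congr rfl fun i _ => ?_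
      simp only [add_mul, Finset.sum_add_distrib, mul_right_comm _ (ξ t), ← Finset.sum_mul]
      ring
    refine (((h.hxi t ht).pow 2).add (((h.hx t ht).pow 2).mul hQ)).congr_deriv ?_
    simp
    ring
  intro t ht
  have hz := abs_sub_le_of_hasDerivAt (C := 0) hder (by simp) t ht
  simpa [sub_eq_zero] using hz

section Bounds

variable {n : ℕ} {ε : ℝ} {U : Set (Fin (n-1) → ℝ)}
  {A : ℝ → (Fin (n-1) → ℝ) → Matrix (Fin (n-1)) (Fin (n-1)) ℝ} {lam Lam : ℝ}
  {y₀ η₀ : Fin (n-1) → ℝ} {s T : ℝ}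
  {x : ℝ → ℝ} {y : ℝ → Fin (n-1) → ℝ} {ξ : ℝ → ℝ} {η : ℝ → Fin (n-1) → ℝ}

lemma IsShortGeo.abs_xi_le (hA : GasGiantData n ε U A lam Lam) (hs : 0 < s)
    (h : IsShortGeo n ε U A y₀ η₀ s T x y ξ η) {t : ℝ} (ht : t ∈ Icc 0 T) : |ξ t| ≤ s := by
  obtain ⟨-, h, hx0, -, hξ0, -, -, -⟩ := h
  have hE := h.energy_eq hA t ht
  obtain ⟨hx, hy⟩ := h.mem t ht
  have hN : 0 ≤ ∑ i, η t i ^ 2 := Finset.sum_nonneg fun i _ => sq_nonneg _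
  have hQ := (mul_nonneg hA.hlam.le hN).trans (hA.hposdef _ hx _ hy (η t)).1
  refine abs_le_of_sq_le_sq ?_ hs.le
  rw [hx0, hξ0] at hE
  nlinarith [mul_nonneg (sq_nonneg (x t)) hQ]

lemma IsShortGeo.sq_mul_normSq_le (hA : GasGiantData n ε U A lam Lam)
    (h : IsShortGeo n ε U A y₀ η₀ s T x y ξ η) {t : ℝ} (ht : t ∈ Icc 0 T) :
    x t ^ 2 * ∑ i, η t i ^ 2 ≤ s ^ 2 / lam := by
  obtain ⟨-, h, hx0, -, hξ0, -, -, -⟩ := h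
  have hE := h.energy_eq hA t ht
  obtain ⟨hx, hy⟩ := h.mem t ht
  have hQ := mul_le_mul_of_nonneg_left (hA.hposdef _ hx _ hy (η t)).1 (sq_nonneg (x t))
  rw [hx0, hξ0] at hE
  rw [le_div_iff₀ hA.hlam]
  nlinarith [sq_nonneg (ξ t)]

lemma IsShortGeo.x_le (hA : GasGiantData n ε U A lam Lam) (hs : 0 < s)
    (h : IsShortGeo n ε U A y₀ η₀ s T x y ξ η) {t : ℝ} (ht : t ∈ Icc 0 T) : x t ≤ s * t := by
  have hb := abs_sub_le_of_hasDerivAt h.2.1.hx (fun u hu => h.abs_xi_le hA hs hu) t ht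
  rw [h.2.2.1, sub_zero] at hb
  exact (le_abs_self _).trans hb

lemma IsShortGeo.abs_eta_sub_le (hA : GasGiantData n ε U A lam Lam)
    (h : IsShortGeo n ε U A y₀ η₀ s T x y ξ η) {t : ℝ} (ht : t ∈ Icc 0 T) (i : Fin (n-1)) :
    |η t i - η₀ i| ≤ Lam * (n-1 : ℕ) / 2 * (s ^ 2 / lam) * t := by
  have hLam : 0 ≤ Lam := hA.hlam.le.trans hA.hlamLam
  have hb := abs_sub_le_of_hasDerivAt (C := Lam * (n-1 : ℕ) / 2 * (s ^ 2 / lam))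
    (fun u hu => h.2.1.heta u hu i) (fun u hu => ?_) t ht
  · rwa [h.2.2.2.2.2.1] at hb
  · obtain ⟨hx, hy⟩ := h.2.1.mem u hu
    have hq := abs_quadForm_le ((hA.hderivBound _ hx _ hy).2 i) (η u)
    calc _ = 1 / 2 * x u ^ 2 * |quadForm (dyA A i (x u) (y u)) (η u) (η u)| := by
          rw [abs_mul, abs_mul, abs_neg, abs_of_nonneg (sq_nonneg (x u))]
          norm_num
      _ ≤ 1 / 2 * x u ^ 2 * (Lam * (n-1 : ℕ) * ∑ i, η u i ^ 2) := by gcongr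
      _ = Lam * (n-1 : ℕ) / 2 * (x u ^ 2 * ∑ i, η u i ^ 2) := by ring
      _ ≤ _ := mul_le_mul_of_nonneg_left (h.sq_mul_normSq_le hA hu) (by positivity)

lemma IsShortGeo.abs_y_sub_le (hA : GasGiantData n ε U A lam Lam) (hs : 0 < s)
    (h : IsShortGeo n ε U A y₀ η₀ s T x y ξ η) {t : ℝ} (ht : t ∈ Icc 0 T) (i : Fin (n-1)) :
    |y t i - y₀ i| ≤ Lam / 2 * (s ^ 2 / lam + (s * T) ^ 2) * t := by
  have hLam : 0 ≤ Lam := hA.hlam.le.trans hA.hlamLam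
  have hb := abs_sub_le_of_hasDerivAt (C := Lam / 2 * (s ^ 2 / lam + (s * T) ^ 2))
    (fun u hu => h.2.1.hy u hu i) (fun u hu => ?_) t ht
  · rwa [h.2.2.2.1] at hb
  · obtain ⟨hx, hy⟩ := h.2.1.mem u hu
    have hq := abs_mulVec_apply_le (hA.hsymm _ hx _ hy)
      (fun v => (mul_nonneg hA.hlam.le (Finset.sum_nonneg fun i _ => sq_nonneg _)).trans
        (hA.hposdef _ hx _ hy v).1) (fun v => (hA.hposdef _ hx _ hy v).2) (η u) i
    have hxT : x u ≤ s * T := (h.x_le hA hs hu).trans (by gcongr; exact hu.2)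
    have hx2 : x u ^ 2 ≤ (s * T) ^ 2 := pow_le_pow_left₀ hx.1 hxT 2
    rw [abs_mul, abs_of_nonneg (sq_nonneg (x u))]
    calc _ ≤ x u ^ 2 * (Lam / 2 * ((∑ j, η u j ^ 2) + 1)) := by gcongr
      _ = Lam / 2 * (x u ^ 2 * (∑ j, η u j ^ 2) + x u ^ 2) := by ring
      _ ≤ _ := by
        gcongr
        exact h.sq_mul_normSq_le hA hu

/-- For small `s`, a short geodesic returns to the boundary before time `π / ω`, where
`ω² = lam / (8 Lam)`. -/
lemma IsShortGeo.time_le (hA : GasGiantData n ε U A lam Lam) (hs : 0 < s)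
    (hη₀ : quadForm (A 0 y₀) η₀ η₀ = 1)
    (h : IsShortGeo n ε U A y₀ η₀ s T x y ξ η) {ω : ℝ} (hω : 0 < ω)
    (hω2 : ω ^ 2 = lam / (8 * Lam))
    (hs1 : s * (Real.pi / ω) * (Lam * (n-1 : ℕ)) ≤ lam)
    (hs2 : (n-1 : ℕ) * (Lam * (n-1 : ℕ) / 2 * (s ^ 2 / lam) * (Real.pi / ω)) ^ 2
      ≤ 1 / (4 * Lam)) :
    T ≤ Real.pi / ω := by
  by_contra! hT
  have hlam := hA.hlam
  have hLam : 0 < Lam := hlam.trans_le hA.hlamLam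
  set P := Real.pi / ω with hP
  have hP0 : 0 < P := by positivity
  have hsub : Icc 0 P ⊆ Icc 0 T := Icc_subset_Icc_right hT.le
  refine (h.2.2.2.2.2.2.2 P ⟨hP0, hT⟩).not_ge ?_
  refine sturm_comparison hω (fun t ht => h.2.1.hx t (hsub ht))
    (fun t ht => h.2.1.hxi t (hsub ht)) (fun t ht => ?_) h.2.2.1
  have htT := hsub ht
  obtain ⟨hx, hy⟩ := h.2.1.mem t htT
  have hN0 : 1 / Lam ≤ ∑ i, η₀ i ^ 2 := by
    obtain ⟨hx', hy'⟩ := h.2.1.mem 0 ⟨le_rfl, h.1.le⟩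
    rw [h.2.2.1] at hx'
    rw [h.2.2.2.1] at hy'
    have := (hA.hposdef _ hx' _ hy' η₀).2
    rw [div_le_iff₀ hLam]
    linarith
  have hD : ∑ i, (η t i - η₀ i) ^ 2 ≤ 1 / (4 * Lam) := by
    refine le_trans ?_ hs2
    have hle : ∀ i ∈ Finset.univ, (η t i - η₀ i) ^ 2
        ≤ (Lam * (n-1 : ℕ) / 2 * (s ^ 2 / lam) * P) ^ 2 := by
      intro i _
      rw [← sq_abs]
      refine pow_le_pow_left₀ (abs_nonneg _) ((h.abs_eta_sub_le hA htT i).trans ?_) 2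
      exact mul_le_mul_of_nonneg_left ht.2 (by positivity)
    simpa using Finset.sum_le_sum hle
  have hN : 1 / (4 * Lam) ≤ ∑ i, η t i ^ 2 := by
    have hsum : ∑ i, η₀ i ^ 2 ≤ 2 * ∑ i, η t i ^ 2 + 2 * ∑ i, (η t i - η₀ i) ^ 2 := by
      rw [Finset.mul_sum, Finset.mul_sum, ← Finset.sum_add_distrib]
      refine Finset.sum_le_sum fun i _ => ?_
      nlinarith [sq_nonneg (2 * η t i - η₀ i)]
    have h4 : 1 / Lam = 4 * (1 / (4 * Lam)) := by field_simp
    linarith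
  have hQ := (hA.hposdef _ hx _ hy (η t)).1
  have hQx := (abs_le.1 (abs_quadForm_le (hA.hderivBound _ hx _ hy).1 (η t))).1
  have hxP : x t * (Lam * (n-1 : ℕ)) ≤ lam := by
    refine le_trans ?_ hs1
    gcongr
    exact (h.x_le hA hs htT).trans (by gcongr; exact ht.2)
  set N := ∑ i, η t i ^ 2
  have hN' : 0 ≤ N := le_trans (by positivity) hN
  have hω3 : ω ^ 2 ≤ lam / 2 * N := by
    calc ω ^ 2 = lam / 2 * (1 / (4 * Lam)) := by rw [hω2]; field_simp; norm_num
      _ ≤ _ := by gcongr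
  have hx0 : 0 ≤ x t := hx.1
  have e1 := mul_le_mul_of_nonneg_left hQ hx0
  have e2 := mul_le_mul_of_nonneg_left hQx (mul_nonneg hx0 hx0)
  have e3 := mul_le_mul_of_nonneg_left hxP (mul_nonneg hx0 hN')
  have e4 := mul_le_mul_of_nonneg_left hω3 hx0
  nlinarith

end Bounds

/-- as `s → 0`, short geodesics with data `(y₀, η₀, s)` converge in the cotangent
bundle to the point `(0, y₀, 0, η₀)` uniformly in `t`, and their `g`-lengths `s·T` tend to `0`;
the threshold `s₀` depends only on `δ`, `n`, `lam`, `Lam`. -/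
theorem stmt_9 (n : ℕ) (hn : 2 ≤ n) (lam Lam : ℝ) (hlam : 0 < lam) (hll : lam ≤ Lam)
    (δ : ℝ) (hδ : 0 < δ) :
    ∃ s₀ > (0:ℝ),
      ∀ (ε : ℝ) (U : Set (Fin (n-1) → ℝ))
        (A : ℝ → (Fin (n-1) → ℝ) → Matrix (Fin (n-1)) (Fin (n-1)) ℝ),
        GasGiantData n ε U A lam Lam →
        ∀ (y₀ η₀ : Fin (n-1) → ℝ), y₀ ∈ U → quadForm (A 0 y₀) η₀ η₀ = 1 →
        ∀ (s T : ℝ)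
          (x : ℝ → ℝ) (y : ℝ → Fin (n-1) → ℝ) (ξ : ℝ → ℝ) (η : ℝ → Fin (n-1) → ℝ),
          0 < s → s < s₀ →
          IsShortGeo n ε U A y₀ η₀ s T x y ξ η →
          (∀ t ∈ Set.Icc (0:ℝ) T,
            x t + euclNorm (fun i => y t i - y₀ i) + |ξ t|
              + euclNorm (fun i => η t i - η₀ i) < δ) ∧
          s * T < δ := by
  have hLam : 0 < Lam := hlam.trans_le hll
  obtain ⟨ω, hω, hω2⟩ : ∃ ω : ℝ, 0 < ω ∧ ω ^ 2 = lam / (8 * Lam) :=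
    ⟨√(lam / (8 * Lam)), by positivity, Real.sq_sqrt (by positivity)⟩
  set P := Real.pi / ω with hP
  have hP0 : 0 < P := by positivity
  have small : ∀ (f : ℝ → ℝ) (c : ℝ), Continuous f → f 0 < c → ∀ᶠ s in 𝓝 (0:ℝ), f s < c :=
    fun f c hf h0 => hf.continuousAt.eventually_lt continuousAt_const h0
  have ev1 := small (fun s => s * P * (Lam * (n-1 : ℕ))) lam (by fun_prop) (by simpa using hlam)
  have ev2 := small (fun s => (n-1 : ℕ) * (Lam * (n-1 : ℕ) / 2 * (s ^ 2 / lam) * P) ^ 2)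
    (1 / (4 * Lam)) (by fun_prop) (by simpa using hLam)
  have ev3 := small (fun s => s * P + (n-1 : ℕ) * (Lam / 2 * (s ^ 2 / lam + (s * P) ^ 2) * P)
    + s + (n-1 : ℕ) * (Lam * (n-1 : ℕ) / 2 * (s ^ 2 / lam) * P)) δ (by fun_prop) (by simpa using hδ)
  obtain ⟨s₀, hs₀, hball⟩ := Metric.eventually_nhds_iff.1 (ev1.and (ev2.and ev3))
  refine ⟨s₀, hs₀, fun ε U A hA y₀ η₀ _ hη₀ s T x y ξ η hs hss h => ?_⟩
  obtain ⟨h1, h2, h3⟩ := hball (y := s) (by rwa [Real.dist_0_eq_abs, abs_of_pos hs])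
  have hT : T ≤ P := h.time_le hA hs hη₀ hω hω2 h1.le h2.le
  have hT0 := h.1
  have hsT : s * T ≤ s * P := by gcongr
  refine ⟨fun t ht => lt_of_le_of_lt ?_ h3, ?_⟩
  · have htP : t ≤ P := ht.2.trans hT
    have ht0 : 0 ≤ t := ht.1
    refine add_le_add (add_le_add (add_le_add ?_ ?_) (h.abs_xi_le hA hs ht)) ?_
    · exact (h.x_le hA hs ht).trans (by gcongr)
    · exact euclNorm_le fun i => (h.abs_y_sub_le hA hs ht i).trans (by gcongr)
    · exact euclNorm_le fun i => (h.abs_eta_sub_le hA ht i).trans (by gcongr)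
  · refine (hsT.trans ?_).trans_lt h3
    rw [add_assoc, add_assoc]
    exact le_add_of_nonneg_right (by positivity)
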